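/- Let g be a continuous real function on S_U ∪ S_L with g(x) < 0 for all x ∈ S_U ∪ S_L. Then Σ_{j=1}^k w_j Φ(f(A_j)) ≤ ( min_{x ∈ S_U} x/g(x) )·g(B_U), and Σ_{j=1}^k w_j Φ(f(A_j)) ≥ ( max_{x ∈ S_L} x/g(x) )·g(B_L), in the Loewner order, where g(B_U) and g(B_L) are defined by continuous functional calculus. -/

import Mathlib

open ContinuousLinearMap in
/-- The Kantorovich constant `K(m', M', r)`, with the convention that it equals `1`
for `r = 0` and `r = 1`. -/
noncomputable def kantorovich (m M r : ℝ) : ℝ :=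
  if r = 0 ∨ r = 1 then 1 else
    ((m * M ^ r - M * m ^ r) / ((r - 1) * (M - m))) *
      (((r - 1) * (M ^ r - m ^ r)) / (r * (m * M ^ r - M * m ^ r))) ^ r

open ContinuousLinearMap Polynomial

theorem one_le_kantorovich {m M : ℝ} (hm : 0 < m) (hmM : m < M) (n : ℕ) :
    1 ≤ kantorovich m M n := by
  unfold kantorovich
  split_ifs with h
  · exact le_rfl
  push Not at h
  have hn : 2 ≤ n := by
    have h0 : n ≠ 0 := by exact_mod_cast h.1
    have h1 : n ≠ 1 := by exact_mod_cast h.2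
    omega
  have hn1 : (0 : ℝ) < n - 1 := by
    have : (2 : ℝ) ≤ n := by exact_mod_cast hn
    linarith
  simp only [Real.rpow_natCast]
  have hM : 0 < M := hm.trans hmM
  have hD : 0 < M - m := sub_pos.2 hmM
  have hpow : m ^ n < M ^ n := pow_lt_pow_left₀ hmM hm.le (by omega)
  have hN : 0 < m * M ^ n - M * m ^ n := by
    obtain ⟨l, rfl⟩ : ∃ l, n = l + 1 := ⟨n - 1, by omega⟩
    have hl : m ^ l < M ^ l := pow_lt_pow_left₀ hmM hm.le (by omega)
    have : 0 < m * M * (M ^ l - m ^ l) := by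
      have := sub_pos.2 hl
      positivity
    calc 0 < m * M * (M ^ l - m ^ l) := this
      _ = _ := by ring
  have hn0 : (0 : ℝ) < n := by linarith
  have hd : 0 < M ^ n - m ^ n := sub_pos.2 hpow
  set u := ((n - 1 : ℝ) * (M ^ n - m ^ n)) / (n * (m * M ^ n - M * m ^ n)) with hu
  have hu0 : 0 < u := by positivity
  have hB := one_add_mul_le_pow (a := m * u - 1) (by nlinarith [mul_pos hm hu0]) n
  rw [add_sub_cancel, mul_pow] at hB
  have hC : 0 < (m * M ^ n - M * m ^ n) / ((n - 1 : ℝ) * (M - m)) := by positivity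
  have key : (m * M ^ n - M * m ^ n) / ((n - 1 : ℝ) * (M - m)) * (1 + n * (m * u - 1)) = m ^ n := by
    rw [hu]
    field_simp
    ring
  have h1 := mul_le_mul_of_nonneg_left hB hC.le
  rw [key] at h1
  have hmn : 0 < m ^ n := by positivity
  refine le_of_mul_le_mul_left ?_ hmn
  linarith

theorem adjoint_conj_mono {H K : Type*} [NormedAddCommGroup H] [InnerProductSpace ℂ H]
    [CompleteSpace H] [NormedAddCommGroup K] [InnerProductSpace ℂ K] [CompleteSpace K]
    (V : K →L[ℂ] H) {X Y : H →L[ℂ] H} (h : X ≤ Y) :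
    adjoint V ∘L X ∘L V ≤ adjoint V ∘L Y ∘L V := by
  rw [ContinuousLinearMap.le_def] at h ⊢
  have := h.adjoint_conj V
  rwa [ContinuousLinearMap.sub_comp, ContinuousLinearMap.comp_sub] at this

theorem sum_smul_adjoint_conj_mono {H K ι : Type*} [NormedAddCommGroup H] [InnerProductSpace ℂ H]
    [CompleteSpace H] [NormedAddCommGroup K] [InnerProductSpace ℂ K] [CompleteSpace K]
    [Fintype ι] (V : K →L[ℂ] H) {w : ι → ℝ} (hw : ∀ j, 0 ≤ w j) {X Y : ι → H →L[ℂ] H}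
    (h : ∀ j, X j ≤ Y j) :
    ∑ j, w j • (adjoint V ∘L X j ∘L V) ≤ ∑ j, w j • (adjoint V ∘L Y j ∘L V) :=
  Finset.sum_le_sum fun j _ => smul_le_smul_of_nonneg_left (adjoint_conj_mono V (h j)) (hw j)

theorem sum_smul_adjoint_conj_algebraMap {H K ι : Type*} [NormedAddCommGroup H]
    [InnerProductSpace ℂ H] [CompleteSpace H] [NormedAddCommGroup K] [InnerProductSpace ℂ K]
    [CompleteSpace K] [Fintype ι] (V : K →L[ℂ] H) (hV : adjoint V ∘L V = 1) {w : ι → ℝ}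
    (hw1 : ∑ j, w j = 1) (r : ℝ) :
    ∑ j, w j • (adjoint V ∘L (algebraMap ℝ (H →L[ℂ] H) r) ∘L V) = algebraMap ℝ (K →L[ℂ] K) r := by
  rw [← Finset.sum_smul, hw1, one_smul, Algebra.algebraMap_eq_smul_one,
    Algebra.algebraMap_eq_smul_one, ContinuousLinearMap.smul_comp, ContinuousLinearMap.comp_smul,
    ← hV]
  rfl

/-- The operator `∑ j, w j • V* q_j(A_j) V`, for a convex combination and an isometry `V`, is
self-adjoint with spectrum in any closed convex set containing the values of the `q_j`. -/
theorem isSelfAdjoint_and_spectrum_subset {H K ι : Type*} [NormedAddCommGroup H]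
    [InnerProductSpace ℂ H] [CompleteSpace H] [NormedAddCommGroup K] [InnerProductSpace ℂ K]
    [CompleteSpace K] [Fintype ι] (V : K →L[ℂ] H) (hV : adjoint V ∘L V = 1) {w : ι → ℝ}
    (hw : ∀ j, 0 ≤ w j) (hw1 : ∑ j, w j = 1) {A : ι → H →L[ℂ] H} (hA : ∀ j, IsSelfAdjoint (A j))
    {q : ι → ℝ → ℝ} (hq : ∀ j, ContinuousOn (q j) (spectrum ℝ (A j))) {S : Set ℝ}
    (hS : IsCompact S) (hSne : S.Nonempty) (hSconv : Convex ℝ S)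
    (hqS : ∀ j, ∀ x ∈ spectrum ℝ (A j), q j x ∈ S) :
    IsSelfAdjoint (∑ j, w j • (adjoint V ∘L cfc (q j) (A j) ∘L V)) ∧
      spectrum ℝ (∑ j, w j • (adjoint V ∘L cfc (q j) (A j) ∘L V)) ⊆ S := by
  have hsa : IsSelfAdjoint (∑ j, w j • (adjoint V ∘L cfc (q j) (A j) ∘L V)) := by
    refine isSelfAdjoint_sum _ fun j _ => IsSelfAdjoint.smul (.all _) ?_
    exact (cfc_predicate (q j) (A j) : IsSelfAdjoint _).adjoint_conj V
  refine ⟨hsa, fun x hx => ?_⟩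
  have hlow : algebraMap ℝ (K →L[ℂ] K) (sInf S) ≤
      ∑ j, w j • (adjoint V ∘L cfc (q j) (A j) ∘L V) := by
    rw [← sum_smul_adjoint_conj_algebraMap V hV hw1]
    exact sum_smul_adjoint_conj_mono V hw fun j =>
      algebraMap_le_cfc _ _ _ (fun x hx => csInf_le hS.bddBelow (hqS j x hx)) (hq j) (hA j)
  have hup : ∑ j, w j • (adjoint V ∘L cfc (q j) (A j) ∘L V) ≤
      algebraMap ℝ (K →L[ℂ] K) (sSup S) := by
    rw [← sum_smul_adjoint_conj_algebraMap V hV hw1]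
    exact sum_smul_adjoint_conj_mono V hw fun j =>
      cfc_le_algebraMap _ _ _ (fun x hx => le_csSup hS.bddAbove (hqS j x hx)) (hq j) (hA j)
  rw [algebraMap_le_iff_le_spectrum (ha := hsa)] at hlow
  rw [le_algebraMap_iff_spectrum_le (ha := hsa)] at hup
  exact hSconv.ordConnected.out (hS.sInf_mem hSne) (hS.sSup_mem hSne) ⟨hlow x hx, hup x hx⟩

theorem sum_smul_cfc_pow {H : Type*} [NormedAddCommGroup H] [InnerProductSpace ℂ H]
    [CompleteSpace H] {A : H →L[ℂ] H} (hA : IsSelfAdjoint A) {f : ℝ → ℝ}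
    (hf : ContinuousOn f (spectrum ℝ A)) (s : Finset ℕ) (a : ℕ → ℝ) :
    ∑ i ∈ s, a i • (cfc f A) ^ i = cfc (fun x => ∑ i ∈ s, a i * f x ^ i) A := by
  have h : (fun x => ∑ i ∈ s, a i * f x ^ i) = ∑ i ∈ s, fun x => a i * f x ^ i := by
    ext x
    simp
  rw [h, cfc_sum (fun i x => a i * f x ^ i) A s fun i _ => by fun_prop]
  refine Finset.sum_congr rfl fun i _ => ?_
  rw [cfc_const_mul (a i) (fun x => f x ^ i) A (by fun_prop), cfc_pow f i A hf hA]

/-- Bounds for `∑ a_i y ^ i` when `l ≤ y ≤ u`, with signs of the coefficients taken into account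
and with slack factors `c_i, d_i ≥ 1`. -/
theorem sum_mul_pow_le_of_one_le {l y u : ℝ} (hl : 0 < l) (hly : l ≤ y) (hyu : y ≤ u)
    (s : Finset ℕ) (a c d : ℕ → ℝ) (hc : ∀ i, 1 ≤ c i) (hd : ∀ i, 1 ≤ d i) :
    ∑ i ∈ s, a i * y ^ i ≤ (∑ i ∈ s with 0 ≤ a i, a i * c i * u ^ i) +
      ∑ i ∈ s with a i < 0, a i * (d i)⁻¹ * l ^ i := by
  have hy : 0 < y := hl.trans_le hly
  rw [← Finset.sum_filter_add_sum_filter_not s (fun i => 0 ≤ a i)]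
  simp only [not_le]
  refine add_le_add (Finset.sum_le_sum fun i hi => ?_) (Finset.sum_le_sum fun i hi => ?_)
  · rw [mul_assoc]
    refine mul_le_mul_of_nonneg_left ?_ (Finset.mem_filter.1 hi).2
    have h1 : y ^ i ≤ u ^ i := pow_le_pow_left₀ hy.le hyu i
    have h2 : 0 ≤ u ^ i := pow_nonneg (hy.le.trans hyu) i
    nlinarith [hc i]
  · rw [mul_assoc]
    refine mul_le_mul_of_nonpos_left ?_ (Finset.mem_filter.1 hi).2.le
    have h1 : l ^ i ≤ y ^ i := pow_le_pow_left₀ hl.le hly i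
    have h2 : 0 ≤ l ^ i := pow_nonneg hl.le i
    nlinarith [inv_le_one_of_one_le₀ (hd i)]

theorem le_sum_mul_pow_of_one_le {l y u : ℝ} (hl : 0 < l) (hly : l ≤ y) (hyu : y ≤ u)
    (s : Finset ℕ) (a c d : ℕ → ℝ) (hc : ∀ i, 1 ≤ c i) (hd : ∀ i, 1 ≤ d i) :
    (∑ i ∈ s with 0 ≤ a i, a i * (d i)⁻¹ * l ^ i) + ∑ i ∈ s with a i < 0, a i * c i * u ^ i ≤
      ∑ i ∈ s, a i * y ^ i := by
  have hy : 0 < y := hl.trans_le hly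
  rw [← Finset.sum_filter_add_sum_filter_not s (fun i => 0 ≤ a i)]
  simp only [not_le]
  refine add_le_add (Finset.sum_le_sum fun i hi => ?_) (Finset.sum_le_sum fun i hi => ?_)
  · rw [mul_assoc]
    refine mul_le_mul_of_nonneg_left ?_ (Finset.mem_filter.1 hi).2
    have h1 : l ^ i ≤ y ^ i := pow_le_pow_left₀ hl.le hly i
    have h2 : 0 ≤ l ^ i := pow_nonneg hl.le i
    nlinarith [inv_le_one_of_one_le₀ (hd i)]
  · rw [mul_assoc]
    refine mul_le_mul_of_nonpos_left ?_ (Finset.mem_filter.1 hi).2.le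
    have h1 : y ^ i ≤ u ^ i := pow_le_pow_left₀ hy.le hyu i
    have h2 : 0 ≤ u ^ i := pow_nonneg (hy.le.trans hyu) i
    nlinarith [hc i]

theorem isCompact_closure_convexHull_iUnion {ι : Type*} [Finite ι] {q : ι → ℝ → ℝ}
    {m M : ι → ℝ} (hq : ∀ j, Continuous (q j)) :
    IsCompact (closure (convexHull ℝ (⋃ j, q j '' Set.Icc (m j) (M j)))) :=
  (isBounded_convexHull.2
    (isCompact_iUnion fun j => isCompact_Icc.image (hq j)).isBounded).isCompact_closure

theorem sInf_image_pos {p : ℝ → ℝ} {m M : ℝ} (hmM : m ≤ M) (hp : ContinuousOn p (Set.Icc m M))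
    (hpos : ∀ x ∈ Set.Icc m M, 0 < p x) : 0 < sInf (p '' Set.Icc m M) := by
  obtain ⟨x, hx, h⟩ := (isCompact_Icc.image_of_continuousOn hp).sInf_mem
    ((Set.nonempty_Icc.2 hmM).image p)
  exact h ▸ hpos x hx

theorem le_sInf_smul_cfc {K : Type*} [NormedAddCommGroup K] [InnerProductSpace ℂ K]
    [CompleteSpace K] {B : K →L[ℂ] K} (hB : IsSelfAdjoint B) {S : Set ℝ} (hS : IsCompact S)
    (hBS : spectrum ℝ B ⊆ S) {g : ℝ → ℝ} (hg : ContinuousOn g S) (hneg : ∀ x ∈ S, g x < 0) :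
    B ≤ sInf ((fun x => x / g x) '' S) • cfc g B := by
  have hbdd : BddBelow ((fun x => x / g x) '' S) := (hS.image_of_continuousOn
    (continuousOn_id.div hg fun x hx => (hneg x hx).ne)).bddBelow
  have hgB : ContinuousOn g (spectrum ℝ B) := hg.mono hBS
  rw [← cfc_const_mul _ g B hgB]
  conv_lhs => rw [← cfc_id ℝ B hB]
  refine cfc_mono (fun x hx => ?_) continuousOn_id (by fun_prop)
  rw [id, ← le_div_iff_of_neg (hneg x (hBS hx))]
  exact csInf_le hbdd ⟨x, hBS hx, rfl⟩

theorem sSup_smul_cfc_le {K : Type*} [NormedAddCommGroup K] [InnerProductSpace ℂ K]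
    [CompleteSpace K] {B : K →L[ℂ] K} (hB : IsSelfAdjoint B) {S : Set ℝ} (hS : IsCompact S)
    (hBS : spectrum ℝ B ⊆ S) {g : ℝ → ℝ} (hg : ContinuousOn g S) (hneg : ∀ x ∈ S, g x < 0) :
    sSup ((fun x => x / g x) '' S) • cfc g B ≤ B := by
  have hbdd : BddAbove ((fun x => x / g x) '' S) := (hS.image_of_continuousOn
    (continuousOn_id.div hg fun x hx => (hneg x hx).ne)).bddAbove
  have hgB : ContinuousOn g (spectrum ℝ B) := hg.mono hBS
  rw [← cfc_const_mul _ g B hgB]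
  conv_rhs => rw [← cfc_id ℝ B hB]
  refine cfc_mono (fun x hx => ?_) (by fun_prop) continuousOn_id
  rw [id, ← div_le_iff_of_neg (hneg x (hBS hx))]
  exact le_csSup hbdd ⟨x, hBS hx, rfl⟩

theorem stmt9
    {H K : Type*} [NormedAddCommGroup H] [InnerProductSpace ℂ H] [CompleteSpace H]
    [NormedAddCommGroup K] [InnerProductSpace ℂ K] [CompleteSpace K]
    (V : K →L[ℂ] H) (hV : (adjoint V) ∘L V = 1)
    (I : ℕ) (a : ℕ → ℝ)
    (k : ℕ) (hk : 1 ≤ k)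
    (w : Fin k → ℝ) (hw : ∀ j, 0 ≤ w j) (hw1 : ∑ j, w j = 1)
    (m M : Fin k → ℝ) (hmM : ∀ j, m j < M j)
    (A : Fin k → H →L[ℂ] H) (hA : ∀ j, IsSelfAdjoint (A j))
    (hspec : ∀ j, spectrum ℝ (A j) ⊆ Set.Icc (m j) (M j))
    (f : ℝ → ℝ) (hf : ContinuousOn f (⋃ j, Set.Icc (m j) (M j)))
    (pL pU : Polynomial ℝ)
    (hp : ∀ x ∈ ⋃ j, Set.Icc (m j) (M j),
      0 < pL.eval x ∧ pL.eval x ≤ f x ∧ f x ≤ pU.eval x)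
    (mU MU mL ML : Fin k → ℝ)
    (hmU : ∀ j, mU j = sInf ((fun x => pU.eval x) '' Set.Icc (m j) (M j)))
    (hMU : ∀ j, MU j = sSup ((fun x => pU.eval x) '' Set.Icc (m j) (M j)))
    (hmL : ∀ j, mL j = sInf ((fun x => pL.eval x) '' Set.Icc (m j) (M j)))
    (hML : ∀ j, ML j = sSup ((fun x => pL.eval x) '' Set.Icc (m j) (M j)))
    (hUlt : ∀ j, mU j < MU j) (hLlt : ∀ j, mL j < ML j)
    (qU qL : Fin k → ℝ → ℝ)
    (hqU : ∀ j x, qU j x =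
      (∑ i ∈ (Finset.range (I + 1)).filter (fun i => 0 ≤ a i),
        a i * kantorovich (mU j) (MU j) (i : ℝ) * (pU.eval x) ^ i) +
      ∑ i ∈ (Finset.range (I + 1)).filter (fun i => a i < 0),
        a i * (kantorovich (mL j) (ML j) (i : ℝ))⁻¹ * (pL.eval x) ^ i)
    (hqL : ∀ j x, qL j x =
      (∑ i ∈ (Finset.range (I + 1)).filter (fun i => 0 ≤ a i),
        a i * (kantorovich (mL j) (ML j) (i : ℝ))⁻¹ * (pL.eval x) ^ i) +
      ∑ i ∈ (Finset.range (I + 1)).filter (fun i => a i < 0),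
        a i * kantorovich (mU j) (MU j) (i : ℝ) * (pU.eval x) ^ i)
    (BU BL : K →L[ℂ] K)
    (hBU : BU = ∑ j, w j • ((adjoint V) ∘L (cfc (qU j) (A j)) ∘L V))
    (hBL : BL = ∑ j, w j • ((adjoint V) ∘L (cfc (qL j) (A j)) ∘L V))
    (SU SL : Set ℝ)
    (hSU : SU = closure (convexHull ℝ (⋃ j, qU j '' Set.Icc (m j) (M j))))
    (hSL : SL = closure (convexHull ℝ (⋃ j, qL j '' Set.Icc (m j) (M j))))
    (g : ℝ → ℝ) (hg : ContinuousOn g (SU ∪ SL)) (hgneg : ∀ x ∈ SU ∪ SL, g x < 0) :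
    ((∑ j, w j • ((adjoint V) ∘L (∑ i ∈ Finset.range (I + 1), a i • (cfc f (A j)) ^ i) ∘L V)) ≤
      (sInf ((fun x => x / g x) '' SU)) • cfc g BU) ∧
    (sSup ((fun x => x / g x) '' SL)) • cfc g BL ≤
      (∑ j, w j • ((adjoint V) ∘L (∑ i ∈ Finset.range (I + 1), a i • (cfc f (A j)) ^ i) ∘L V)) := by
  have hmem : ∀ {j x}, x ∈ Set.Icc (m j) (M j) → x ∈ ⋃ j, Set.Icc (m j) (M j) :=
    fun {j _} hx => Set.mem_iUnion.2 ⟨j, hx⟩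
  have hKU : ∀ j (i : ℕ), 1 ≤ kantorovich (mU j) (MU j) i := fun j i =>
    one_le_kantorovich (hmU j ▸ sInf_image_pos (hmM j).le (by fun_prop) fun x hx =>
      have h := hp x (hmem hx)
      h.1.trans_le (h.2.1.trans h.2.2)) (hUlt j) i
  have hKL : ∀ j (i : ℕ), 1 ≤ kantorovich (mL j) (ML j) i := fun j i =>
    one_le_kantorovich (hmL j ▸ sInf_image_pos (hmM j).le (by fun_prop) fun x hx =>
      (hp x (hmem hx)).1) (hLlt j) i
  have hqUc : ∀ j, Continuous (qU j) := fun j => by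
    rw [funext (hqU j)]
    fun_prop
  have hqLc : ∀ j, Continuous (qL j) := fun j => by
    rw [funext (hqL j)]
    fun_prop
  have hfA : ∀ j, ContinuousOn f (spectrum ℝ (A j)) := fun j =>
    hf.mono ((hspec j).trans (Set.subset_iUnion_of_subset j subset_rfl))
  have hval : ∀ (q : Fin k → ℝ → ℝ) j, ∀ x ∈ Set.Icc (m j) (M j),
      q j x ∈ closure (convexHull ℝ (⋃ j, q j '' Set.Icc (m j) (M j))) := fun q j x hx =>
    subset_closure (subset_convexHull ℝ _ (Set.mem_iUnion.2 ⟨j, x, hx, rfl⟩))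
  have hne : ∀ q : Fin k → ℝ → ℝ,
      (closure (convexHull ℝ (⋃ j, q j '' Set.Icc (m j) (M j)))).Nonempty := fun q =>
    ⟨_, hval q ⟨0, hk⟩ _ (Set.left_mem_Icc.2 (hmM _).le)⟩
  have hSUc : IsCompact SU := hSU ▸ isCompact_closure_convexHull_iUnion hqUc
  have hSLc : IsCompact SL := hSL ▸ isCompact_closure_convexHull_iUnion hqLc
  obtain ⟨hBUsa, hBUS⟩ := isSelfAdjoint_and_spectrum_subset V hV hw hw1 hA
    (fun j => (hqUc j).continuousOn) hSUc (hSU ▸ hne qU) (hSU ▸ (convex_convexHull ℝ _).closure)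
    fun j x hx => hSU ▸ hval qU j x (hspec j hx)
  obtain ⟨hBLsa, hBLS⟩ := isSelfAdjoint_and_spectrum_subset V hV hw hw1 hA
    (fun j => (hqLc j).continuousOn) hSLc (hSL ▸ hne qL) (hSL ▸ (convex_convexHull ℝ _).closure)
    fun j x hx => hSL ▸ hval qL j x (hspec j hx)
  rw [← hBU] at hBUsa hBUS
  rw [← hBL] at hBLsa hBLS
  constructor
  · refine le_trans ?_ (le_sInf_smul_cfc hBUsa hSUc hBUS (hg.mono Set.subset_union_left)
      fun x hx => hgneg x (Or.inl hx))
    rw [hBU]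
    refine sum_smul_adjoint_conj_mono V hw fun j => ?_
    have hfj := hfA j
    rw [sum_smul_cfc_pow (hA j) hfj]
    refine cfc_mono (fun x hx => ?_) (by fun_prop) (hqUc j).continuousOn
    obtain ⟨h0, h1, h2⟩ := hp x (hmem (hspec j hx))
    rw [hqU]
    exact sum_mul_pow_le_of_one_le h0 h1 h2 _ a _ _ (hKU j) (hKL j)
  · refine (sSup_smul_cfc_le hBLsa hSLc hBLS (hg.mono Set.subset_union_right)
      fun x hx => hgneg x (Or.inr hx)).trans ?_
    rw [hBL]
    refine sum_smul_adjoint_conj_mono V hw fun j => ?_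
    have hfj := hfA j
    rw [sum_smul_cfc_pow (hA j) hfj]
    refine cfc_mono (fun x hx => ?_) (hqLc j).continuousOn (by fun_prop)
    obtain ⟨h0, h1, h2⟩ := hp x (hmem (hspec j hx))
    rw [hqL]
    exact le_sum_mul_pow_of_one_le h0 h1 h2 _ a _ _ (hKU j) (hKL j)
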